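/- Let K and L be star-shaped bodies with respect to the origin in ℝ⁴ satisfying the hypotheses above (countably many diameters; a diameter d_K(ζ) of K through the origin parallel to ζ; for every w ∈ S²(ζ) the sections K ∩ w^⊥ and L ∩ w^⊥ directly congruent and without (ζ,π)- and (u,π)-symmetries), and let a ∈ ℝ⁴ parallel to ζ be such that L̃ = L + a is star-shaped with respect to the origin with d_K(ζ) = d_{L̃}(ζ). Then for every w ∈ Ω^r = {w ∈ S²(ζ) : (A_K ∪ A_L) ∩ S²(w) = {±ζ}} there exists a rotation φ_w ∈ SO(3, S²(w)) with φ_w(ζ) = ±ζ such that ρ_K(φ_w(θ)) = ρ_{L̃}(θ) for all θ ∈ S²(w). -/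

import Mathlib

noncomputable section

open scoped RealInnerProductSpace

/-- `ℝ⁴` as a Euclidean space. -/
abbrev E4 := EuclideanSpace ℝ (Fin 4)

/-- The unit sphere `S³` in `ℝ⁴`. -/
def sph : Set E4 := Metric.sphere (0 : E4) 1

/-- The great subsphere `S²(w) = {θ ∈ S³ : θ·w = 0}`. -/
def S2 (w : E4) : Set E4 := {θ ∈ sph | ⟪θ, w⟫ = 0}

/-- The orthogonal transformation `𝒪` determined by `ζ`: for a unit vector `ζ` the map
`x ↦ 2⟪x,ζ⟫ζ - x` satisfies `𝒪 ζ = ζ` and `𝒪 = -I` on `ζ^⊥`. -/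
def Ocal (ζ x : E4) : E4 := (2 * ⟪x, ζ⟫) • ζ - x

/-- `φ` is (the extension to `ℝ⁴` of) an element of `SO(3, S²(w))`:
a linear isometry of `ℝ⁴` fixing `w`, of determinant `1`, i.e. a rotation
of the `3`-dimensional subspace `w^⊥`. -/
def IsRot (w : E4) (φ : E4 ≃ₗᵢ[ℝ] E4) : Prop :=
  φ w = w ∧ LinearMap.det (φ.toLinearEquiv : E4 →ₗ[ℝ] E4) = 1

/-- `φ ∈ SO(3, S²(w))` is a rotation by the angle `α·π` around the axis `u ∈ S²(w)`:
it fixes `w` and `u`, and turns the plane orthogonal to `w` and `u` by the angle `α·π`. -/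
def IsRotAngleAbout (w u : E4) (α : ℝ) (φ : E4 ≃ₗᵢ[ℝ] E4) : Prop :=
  IsRot w φ ∧ φ u = u ∧
    ∀ v : E4, ⟪v, w⟫ = 0 → ⟪v, u⟫ = 0 →
      ⟪φ v, v⟫ = Real.cos (α * Real.pi) * ⟪v, v⟫

/-- A body: a compact set which is the closure of its nonempty interior. -/
def IsBody (K : Set E4) : Prop := IsCompact K ∧ (interior K).Nonempty ∧ K = closure (interior K)

/-- `K` is star-shaped with respect to the origin. -/
def StarShapedO (K : Set E4) : Prop := ∀ x ∈ K, ∀ t : ℝ, t ∈ Set.Icc (0:ℝ) 1 → t • x ∈ K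

/-- The radial function of `K`: `ρ_K(x) = max {c : c • x ∈ K}`. -/
def radialFn (K : Set E4) (x : E4) : ℝ := sSup {c : ℝ | c • x ∈ K}

/-- A star body with respect to the origin: a body, star-shaped with respect to the
origin, with continuous radial function. -/
def IsStarBody (K : Set E4) : Prop := IsBody K ∧ StarShapedO K ∧ ContinuousOn (radialFn K) sph

/-- The supremum of lengths of segments contained in `K`. -/
def chordSup (K : Set E4) : ℝ := sSup {d : ℝ | ∃ z y : E4, segment ℝ z y ⊆ K ∧ d = dist z y}

/-- A diameter of the star body `K`: a segment `[z, y] ⊆ K` of maximal length. -/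
def IsDiamStar (K : Set E4) (z y : E4) : Prop := segment ℝ z y ⊆ K ∧ dist z y = chordSup K

/-- `K` has countably many diameters. -/
def CountablyManyDiamsStar (K : Set E4) : Prop := {p : E4 × E4 | IsDiamStar K p.1 p.2}.Countable

/-- Directions of diameters of the star body `K`. -/
def starDiamDirs (K : Set E4) : Set E4 :=
  {θ ∈ sph | ∃ z y : E4, IsDiamStar K z y ∧ y - z = dist z y • θ}

/-- The section `K ∩ w^⊥`. -/
def sect (w : E4) (K : Set E4) : Set E4 := {x ∈ K | ⟪x, w⟫ = 0}

/-- Subsets `D₁`, `D₂` of `w^⊥` are directly congruent: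
`φ(D₁) = D₂ + a` for some rotation `φ ∈ SO(3, w^⊥)` and some `a ∈ w^⊥`. -/
def DirCong (w : E4) (D₁ D₂ : Set E4) : Prop :=
  ∃ φ : E4 ≃ₗᵢ[ℝ] E4, IsRot w φ ∧
    ∃ a : E4, ⟪a, w⟫ = 0 ∧ φ '' D₁ = (fun x => x + a) '' D₂

/-- The subset `D` of the `3`-dimensional subspace `w^⊥` has a `(u, π)`-symmetry. -/
def HasPiSymSet (w u : E4) (D : Set E4) : Prop :=
  ∃ φ : E4 ≃ₗᵢ[ℝ] E4, IsRotAngleAbout w u 1 φ ∧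
    ∃ a : E4, ⟪a, w⟫ = 0 ∧ φ '' D = (fun x => x + a) '' D

/-- The set `Ω^r = {w ∈ S²(ζ) : (A_K ∪ A_L) ∩ S²(w) = {±ζ}}`. -/
def OmegaR (K L : Set E4) (ζ : E4) : Set E4 :=
  {w ∈ S2 ζ | (starDiamDirs K ∪ starDiamDirs L) ∩ S2 w = {ζ, -ζ}}


theorem IsPreconnected.eq_of_circleExp_eq_one {X : Type*} [TopologicalSpace X] {s : Set X}
    (hs : IsPreconnected s) {f : X → ℝ} (hf : ContinuousOn f s)
    (h1 : ∀ x ∈ s, Circle.exp (f x) = 1) {x y : X} (hx : x ∈ s) (hy : y ∈ s) : f x = f y := by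
  have hT : IsDiscrete (Set.range fun n : ℤ => (n : ℝ)) :=
    ⟨Int.isClosedEmbedding_coe_real.isEmbedding.toHomeomorph.symm.isEmbedding.discreteTopology⟩
  have hmaps : Set.MapsTo (fun x => f x / (2 * Real.pi)) s (Set.range fun n : ℤ => (n : ℝ)) := by
    intro z hz
    obtain ⟨n, hn⟩ := Circle.exp_eq_one.1 (h1 z hz)
    refine ⟨n, ?_⟩
    have := Real.pi_ne_zero
    simp only [hn]
    field_simp
  have := hs.constant_of_mapsTo (f := fun x => f x / (2 * Real.pi)) hT
    (hf.div_const _) hmaps hx hy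
  have hpi := Real.pi_ne_zero
  field_simp at this
  exact this

theorem false_of_twisted_circle_map {q : ℝ × ℝ → Circle} (hq : Continuous q) {k : ℝ} (hk : k ≠ 0)
    (h0 : ∀ φ ∈ Set.Icc 0 (2 * Real.pi), q (0, φ) = q (0, 0) * Circle.exp (-(k * φ)))
    (hpi : ∀ φ ∈ Set.Icc 0 (2 * Real.pi), q (Real.pi, φ) = q (Real.pi, 0) * Circle.exp (k * φ))
    (hper : ∀ θ ∈ Set.Icc 0 Real.pi, q (θ, 2 * Real.pi) = q (θ, 0)) : False := by
  obtain ⟨t₀, ht₀⟩ := Circle.exp_surjective (q (0, 0))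
  obtain ⟨α, ⟨-, hα⟩, -⟩ := Circle.isCoveringMap_exp.existsUnique_continuousMap_lifts
    (⟨q, hq⟩ : C(ℝ × ℝ, Circle)) (0, 0) t₀ ht₀
  have hα' : ∀ p, Circle.exp (α p) = q p := fun p => congrFun hα p
  have hpos := Real.pi_pos
  have e1 := (isPreconnected_Icc (a := (0 : ℝ)) (b := 2 * Real.pi)).eq_of_circleExp_eq_one
    (f := fun φ => α (0, φ) - α (0, 0) + k * φ) (by fun_prop)
    (fun φ hφ => by
      rw [Circle.exp_add, Circle.exp_sub, hα', hα', h0 φ hφ, Circle.exp_neg]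
      simp) (x := 0) (y := 2 * Real.pi) (by simp; positivity) (by simp; positivity)
  have e2 := (isPreconnected_Icc (a := (0 : ℝ)) (b := 2 * Real.pi)).eq_of_circleExp_eq_one
    (f := fun φ => α (Real.pi, φ) - α (Real.pi, 0) - k * φ) (by fun_prop)
    (fun φ hφ => by
      rw [Circle.exp_sub, Circle.exp_sub, hα', hα', hpi φ hφ]
      simp) (x := 0) (y := 2 * Real.pi) (by simp; positivity) (by simp; positivity)
  have e3 := (isPreconnected_Icc (a := (0 : ℝ)) (b := Real.pi)).eq_of_circleExp_eq_one
    (f := fun θ => α (θ, 2 * Real.pi) - α (θ, 0)) (by fun_prop)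
    (fun θ hθ => by
      rw [Circle.exp_sub, hα', hα', hper θ hθ]
      simp) (x := 0) (y := Real.pi) (by simp; positivity) (by simp; positivity)
  have : k * Real.pi = 0 := by linarith
  exact (mul_ne_zero hk hpos.ne') this

/-- If no power of `z` comes within `ε` of `-1`, then `z` is a torsion element whose order is
bounded in terms of `ε`. -/
theorem Circle.exists_pow_eq_one_of_powers_far_from_neg_one {ε : ℝ} (hε : 0 < ε) :
    ∃ M : ℕ, M ≠ 0 ∧ ∀ z : Circle, (∀ n : ℕ, ε ≤ ‖((z ^ n : Circle) : ℂ) + 1‖) → z ^ M = 1 := by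
  have hpi := Real.pi_pos
  obtain ⟨N, hN⟩ := exists_nat_gt (2 * Real.pi / ε)
  have hNpos : 0 < N := by
    have : (0 : ℝ) < N := lt_trans (by positivity) hN
    exact_mod_cast this
  refine ⟨N.factorial, N.factorial_ne_zero, fun z hz => ?_⟩
  obtain ⟨t, rfl⟩ := Circle.exp_surjective z
  obtain ⟨j, hj0, hjN, hj⟩ := Real.exists_nat_abs_mul_sub_round_le (t / (2 * Real.pi)) hNpos
  set s : ℝ := j * t - round (j * (t / (2 * Real.pi))) * (2 * Real.pi) with hs
  have hes : Circle.exp s = Circle.exp t ^ j := by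
    rw [hs, Circle.exp_sub, Circle.exp_int_mul_two_pi]
    simp
  have hsε : |s| < ε := by
    have h1 : s = (j * (t / (2 * Real.pi)) - round (j * (t / (2 * Real.pi)))) * (2 * Real.pi) := by
      rw [hs]; field_simp
    rw [h1, abs_mul, abs_of_pos (show 0 < 2 * Real.pi by positivity)]
    calc _ ≤ 1 / (N + 1 : ℝ) * (2 * Real.pi) := by gcongr
      _ < ε := by
        rw [div_lt_iff₀ hε] at hN
        rw [one_div, inv_mul_lt_iff₀ (by positivity)]
        nlinarith
  have hpow : Circle.exp t ^ j = 1 := by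
    by_contra hne
    have hs0 : s ≠ 0 := by
      intro h0; rw [h0, Circle.exp_zero] at hes; exact hne hes.symm
    have hs0' : 0 < |s| := abs_pos.2 hs0
    set n := ⌊Real.pi / |s|⌋₊ with hn
    have hn1 : n * |s| ≤ Real.pi := by
      rw [← le_div_iff₀ hs0']; exact Nat.floor_le (by positivity)
    have hn2 : Real.pi < (n + 1) * |s| := by
      rw [← div_lt_iff₀ hs0']; exact Nat.lt_floor_add_one _
    have hfar := hz (j * n)
    rw [pow_mul, ← hes] at hfar
    have key : ∀ r : ℝ, ‖((Circle.exp r : Circle) : ℂ) + 1‖ ≤ |r - Real.pi| := by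
      intro r
      have h := Real.norm_exp_I_mul_ofReal_sub_one_le (x := r - Real.pi)
      have h2 : Complex.exp (Complex.I * ((r - Real.pi : ℝ) : ℂ)) = - Complex.exp (r * Complex.I) := by
        push_cast
        rw [mul_sub, Complex.exp_sub, mul_comm Complex.I (Real.pi : ℂ), Complex.exp_pi_mul_I, mul_comm]
        rw [div_neg, div_one]
      rw [h2] at h
      rw [Circle.coe_exp, ← norm_neg]
      rw [neg_add, ← sub_eq_add_neg]
      simpa using h
    have hnorm : ‖((Circle.exp s ^ n : Circle) : ℂ) + 1‖ ≤ |(n * |s|) - Real.pi| := by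
      rcases abs_choice s with h | h
      · rw [h]
        have := key (n * s)
        rwa [← nsmul_eq_mul, Circle.exp_nsmul, nsmul_eq_mul] at this
      · rw [h]
        have := key (n * (-s))
        rw [← nsmul_eq_mul, Circle.exp_nsmul, nsmul_eq_mul] at this
        refine le_trans (le_of_eq ?_) this
        rw [Circle.exp_neg, inv_pow, Circle.coe_inv_eq_conj, ← Complex.norm_conj,
          map_add, map_one]
    have : |(n * |s|) - Real.pi| < ε := by
      rw [abs_of_nonpos (by linarith)]; linarith
    linarith
  obtain ⟨d, hd⟩ := Nat.dvd_factorial hj0 hjN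
  rw [hd, pow_mul, hpow, one_pow]

/-- A closed and lower hemicontinuous family of sets. -/
structure IsContinuousFamily {P X : Type*} [TopologicalSpace P] [TopologicalSpace X]
    (T : P → Set X) : Prop where
  isClosed : IsClosed {q : P × X | q.2 ∈ T q.1}
  exists_selection : ∀ p, ∀ x ∈ T p, ∃ h : P → X, ContinuousAt h p ∧ h p = x ∧ ∀ p', h p' ∈ T p'

namespace IsContinuousFamily

variable {P X C : Type*} [TopologicalSpace P] [TopologicalSpace X] [TopologicalSpace C]
  {T T' : P → Set X}

theorem isClosed_mapsTo (hT : IsContinuousFamily T) (hT' : IsContinuousFamily T')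
    {α : C → X → X} (hα : Continuous fun q : C × X => α q.1 q.2) :
    IsClosed {q : P × C | ∀ x ∈ T q.1, α q.2 x ∈ T' q.1} := by
  refine isClosed_of_closure_subset ?_
  rintro ⟨p, c⟩ hpc x hx
  obtain ⟨h, hcont, rfl, hmem⟩ := hT.exists_selection p x hx
  have h1 : ContinuousAt (fun q : P × C => (q.1, α q.2 (h q.1))) (p, c) := by
    refine continuousAt_fst.prodMk ?_
    have h2 : ContinuousAt (fun q : P × C => (q.2, h q.1)) (p, c) :=
      continuousAt_snd.prodMk (ContinuousAt.comp (f := Prod.fst) (x := (p, c)) hcont continuousAt_fst)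
    exact ContinuousAt.comp (g := fun q : C × X => α q.1 q.2) hα.continuousAt h2
  have := h1.continuousWithinAt.mem_closure hpc (t := {q : P × X | q.2 ∈ T' q.1})
    (fun q hq => hq _ (hmem _))
  rwa [hT'.isClosed.closure_eq] at this

theorem isClosed_iff (hT : IsContinuousFamily T) (hT' : IsContinuousFamily T')
    {α β : C → X → X} (hα : Continuous fun q : C × X => α q.1 q.2)
    (hβ : Continuous fun q : C × X => β q.1 q.2)
    (hαβ : ∀ c x, α c (β c x) = x) (hβα : ∀ c x, β c (α c x) = x) :
    IsClosed {q : P × C | ∀ x, x ∈ T q.1 ↔ α q.2 x ∈ T' q.1} := by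
  have := (isClosed_mapsTo hT hT' hα).inter (isClosed_mapsTo hT' hT hβ)
  convert this using 1
  ext ⟨p, c⟩
  refine ⟨fun h => ⟨fun x hx => (h x).1 hx, fun x hx => (h _).2 (by simpa [hαβ] using hx)⟩,
    fun h x => ⟨fun hx => h.1 x hx, fun hx => ?_⟩⟩
  have := h.2 _ hx
  rwa [hβα] at this

end IsContinuousFamily

/-- Rotation about the second axis of `ℂ × ℝ`. -/
def rotC (c : Circle) (x : ℂ × ℝ) : ℂ × ℝ := (c * x.1, x.2)

/-- Half-turn of `ℂ × ℝ` about a horizontal line through `(0, μ / 2)`. -/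
def flipC (μ : ℝ) (c : Circle) (x : ℂ × ℝ) : ℂ × ℝ := (c * starRingEnd ℂ x.1, μ - x.2)

theorem continuous_rotC : Continuous fun q : Circle × (ℂ × ℝ) => rotC q.1 q.2 := by
  unfold rotC; fun_prop

theorem continuous_flipC (μ : ℝ) : Continuous fun q : Circle × (ℂ × ℝ) => flipC μ q.1 q.2 := by
  unfold flipC
  have := Complex.continuous_conj
  fun_prop

theorem rotC_rotC (c d : Circle) (x : ℂ × ℝ) : rotC c (rotC d x) = rotC (c * d) x := by
  simp [rotC, mul_assoc]

theorem rotC_one (x : ℂ × ℝ) : rotC 1 x = x := by simp [rotC]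

theorem rotC_flipC (μ : ℝ) (c d : Circle) (x : ℂ × ℝ) :
    rotC c (flipC μ d x) = flipC μ (c * d) x := by
  simp [rotC, flipC, mul_assoc]

theorem flipC_rotC (μ : ℝ) (c d : Circle) (x : ℂ × ℝ) :
    flipC μ c (rotC d x) = flipC μ (c * d⁻¹) x := by
  simp only [rotC, flipC, Circle.coe_mul, Circle.coe_inv_eq_conj, map_mul, mul_assoc]

theorem flipC_flipC (μ : ℝ) (c d : Circle) (x : ℂ × ℝ) :
    flipC μ c (flipC μ d x) = rotC (c * d⁻¹) x := by
  simp only [rotC, flipC, Circle.coe_mul, Circle.coe_inv_eq_conj, map_mul, mul_assoc,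
    Complex.conj_conj, sub_sub_cancel]

/-- Two continuous families of sets over the spherical coordinates, one without half-turn symmetries
about the second axis and the other without horizontal half-turn symmetries, which are related over
a dense set of parameters by rotations or by horizontal half-turns, are related by a rotation at the
pole. -/
theorem exists_rotC_of_dense {T₁ T₂ : ℝ × ℝ → Set (ℂ × ℝ)} (h₁ : IsContinuousFamily T₁)
    (h₂ : IsContinuousFamily T₂) (μ : ℝ)
    (hrot : ∀ p, ∀ c : Circle, (c : ℂ) = -1 → ¬ ∀ x, x ∈ T₂ p ↔ rotC c x ∈ T₂ p)
    (hflip : ∀ p c, ¬ ∀ x, x ∈ T₁ p ↔ flipC μ c x ∈ T₁ p)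
    (hdense : Dense {p | (∃ c, ∀ x, x ∈ T₁ p ↔ rotC c x ∈ T₂ p) ∨
      ∃ c, ∀ x, x ∈ T₁ p ↔ flipC μ c x ∈ T₂ p})
    (hzero₁ : ∀ φ x, x ∈ T₁ (0, φ) ↔ rotC (Circle.exp φ) x ∈ T₁ (0, 0))
    (hzero₂ : ∀ φ x, x ∈ T₂ (0, φ) ↔ rotC (Circle.exp φ) x ∈ T₂ (0, 0))
    (hpi₁ : ∀ φ x, x ∈ T₁ (Real.pi, φ) ↔ rotC (Circle.exp (-φ)) x ∈ T₁ (Real.pi, 0))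
    (hpi₂ : ∀ φ x, x ∈ T₂ (Real.pi, φ) ↔ rotC (Circle.exp (-φ)) x ∈ T₂ (Real.pi, 0))
    (hper₁ : ∀ θ, T₁ (θ, 2 * Real.pi) = T₁ (θ, 0))
    (hper₂ : ∀ θ, T₂ (θ, 2 * Real.pi) = T₂ (θ, 0)) :
    ∃ c, ∀ x, x ∈ T₁ (0, 0) ↔ rotC c x ∈ T₂ (0, 0) := by
  have hpos := Real.pi_pos
  have hrotinv : Continuous fun q : Circle × (ℂ × ℝ) => rotC q.1⁻¹ q.2 :=
    continuous_rotC.comp (continuous_fst.inv.prodMk continuous_snd)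
  have closedA := h₁.isClosed_iff h₂ continuous_rotC (β := fun c => rotC c⁻¹) hrotinv
    (by simp [rotC_rotC, rotC_one])
    (by simp [rotC_rotC, rotC_one])
  have closedB := h₁.isClosed_iff h₂ (continuous_flipC μ) (continuous_flipC μ)
    (by simp [flipC_flipC, rotC_one]) (by simp [flipC_flipC, rotC_one])
  have closedG := h₂.isClosed_iff h₂ continuous_rotC (β := fun c => rotC c⁻¹) hrotinv
    (by simp [rotC_rotC, rotC_one])
    (by simp [rotC_rotC, rotC_one])
  have closedPA := isClosedMap_fst_of_compactSpace _ closedA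
  have closedPB := isClosedMap_fst_of_compactSpace _ closedB
  set A : Set (ℝ × ℝ) := Prod.fst ''
    {q : (ℝ × ℝ) × Circle | ∀ x, x ∈ T₁ q.1 ↔ rotC q.2 x ∈ T₂ q.1} with hA
  set B : Set (ℝ × ℝ) := Prod.fst ''
    {q : (ℝ × ℝ) × Circle | ∀ x, x ∈ T₁ q.1 ↔ flipC μ q.2 x ∈ T₂ q.1} with hB
  have memA : ∀ p, p ∈ A ↔ ∃ c, ∀ x, x ∈ T₁ p ↔ rotC c x ∈ T₂ p := by simp [hA]
  have memB : ∀ p, p ∈ B ↔ ∃ c, ∀ x, x ∈ T₁ p ↔ flipC μ c x ∈ T₂ p := by simp [hB]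
  have cover : A ∪ B = Set.univ := by
    refine (closedPA.union closedPB).closure_eq.symm.trans (Dense.closure_eq ?_)
    refine hdense.mono fun p hp => ?_
    rcases hp with hp | hp
    · exact Or.inl ((memA p).2 hp)
    · exact Or.inr ((memB p).2 hp)
  have disj : A ∩ B = ∅ := by
    refine Set.eq_empty_iff_forall_notMem.2 fun p hp => ?_
    obtain ⟨c, hc⟩ := (memA p).1 hp.1
    obtain ⟨d, hd⟩ := (memB p).1 hp.2
    refine hflip p (c⁻¹ * d) fun x => ?_
    rw [hd, ← rotC_flipC, hc, rotC_rotC, mul_inv_cancel, rotC_one]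
  by_contra hcon
  have hBall : ∀ p, ∃ c, ∀ x, x ∈ T₁ p ↔ flipC μ c x ∈ T₂ p := by
    have hcompl : B = Aᶜ := by
      ext p
      have h1 : p ∈ A ∪ B := cover ▸ Set.mem_univ p
      have h2 : p ∉ A ∩ B := disj ▸ Set.notMem_empty p
      simp only [Set.mem_union, Set.mem_inter_iff, Set.mem_compl_iff] at *
      tauto
    have hclopen : IsClopen A := ⟨closedPA, by
      rw [← isClosed_compl_iff, ← hcompl]; exact closedPB⟩
    rcases isClopen_iff.1 hclopen with h | h
    · intro p
      rw [← memB, hcompl, h]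
      simp
    · exact absurd ((memA (0, 0)).1 (h ▸ Set.mem_univ _)) hcon
  -- the symmetry groups of the sections are uniformly torsion
  set R : Set (ℝ × ℝ) := Set.Icc 0 Real.pi ×ˢ Set.Icc 0 (2 * Real.pi) with hR
  have hRc : IsCompact (R ×ˢ (Set.univ : Set Circle)) :=
    (isCompact_Icc.prod isCompact_Icc).prod isCompact_univ
  obtain ⟨ε, hε, hfar⟩ := (hRc.inter_right closedG).exists_forall_le'
    (f := fun q => ‖(q.2 : ℂ) + 1‖) (by fun_prop) (a := 0) (by
      rintro ⟨p, c⟩ ⟨-, hc⟩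
      refine norm_pos_iff.2 fun h => hrot p c ?_ hc
      exact eq_neg_of_add_eq_zero_left h)
  obtain ⟨M, hM0, hM⟩ := Circle.exists_pow_eq_one_of_powers_far_from_neg_one hε
  have torsion : ∀ p ∈ R, ∀ c : Circle, (∀ x, x ∈ T₂ p ↔ rotC c x ∈ T₂ p) → c ^ M = 1 := by
    intro p hp c hc
    refine hM c fun n => hfar (p, c ^ n) ⟨⟨hp, Set.mem_univ _⟩, ?_⟩
    induction n with
    | zero => simp [rotC_one]
    | succ n ih =>
      intro x
      change _ ↔ rotC (c ^ (n + 1)) x ∈ T₂ p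
      rw [hc x, pow_succ, ← rotC_rotC]
      exact ih _
  have unique : ∀ p ∈ R, ∀ c d : Circle, (∀ x, x ∈ T₁ p ↔ flipC μ c x ∈ T₂ p) →
      (∀ x, x ∈ T₁ p ↔ flipC μ d x ∈ T₂ p) → c ^ M = d ^ M := by
    intro p hp c d hc hd
    have := torsion p hp (c * d⁻¹) fun x => by
      rw [← flipC_flipC μ, ← hc, hd, flipC_flipC, mul_inv_cancel, rotC_one]
    rwa [mul_pow, inv_pow, mul_inv_eq_one] at this
  choose c hc using hBall
  set clamp : ℝ × ℝ → ℝ × ℝ := fun p =>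
    (Set.projIcc 0 Real.pi hpos.le p.1, Set.projIcc 0 (2 * Real.pi) (by positivity) p.2)
  have hclampR : ∀ p, clamp p ∈ R := fun p => ⟨Subtype.coe_prop _, Subtype.coe_prop _⟩
  have hclamp : ∀ p ∈ R, clamp p = p := by
    rintro ⟨θ, φ⟩ ⟨h1, h2⟩
    simp only [clamp, Set.projIcc_of_mem _ h1, Set.projIcc_of_mem _ h2]
  have hclampC : Continuous clamp := by
    refine Continuous.prodMk ?_ ?_
    · exact continuous_subtype_val.comp (continuous_projIcc.comp continuous_fst)
    · exact continuous_subtype_val.comp (continuous_projIcc.comp continuous_snd)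
  have hqcont : Continuous fun p => c (clamp p) ^ M := by
    refine continuous_iff_isClosed.2 fun s hs => ?_
    have h1 : IsClosed ({q : (ℝ × ℝ) × Circle |
        ∀ x, x ∈ T₁ (clamp q.1) ↔ flipC μ q.2 x ∈ T₂ (clamp q.1)} ∩ {q | q.2 ^ M ∈ s}) :=
      (closedB.preimage ((hclampC.comp continuous_fst).prodMk continuous_snd)).inter
        (hs.preimage (continuous_snd.pow M))
    convert isClosedMap_fst_of_compactSpace _ h1 using 1
    ext p
    simp only [Set.mem_preimage, Set.mem_image, Prod.exists, exists_and_right, exists_eq_right,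
      Set.mem_inter_iff, Set.mem_ofPred_eq]
    refine ⟨fun h => ⟨_, hc _, h⟩, ?_⟩
    rintro ⟨d, hd, hds⟩
    rwa [unique _ (hclampR p) _ d (hc _) hd]
  have hq : ∀ p ∈ R, ∀ d, (∀ x, x ∈ T₁ p ↔ flipC μ d x ∈ T₂ p) → c (clamp p) ^ M = d ^ M := by
    intro p hp d hd
    rw [hclamp p hp]
    exact unique p hp _ d (hc p) hd
  have hz : (0 : ℝ) ∈ Set.Icc 0 (2 * Real.pi) := ⟨le_rfl, by positivity⟩
  have hz' : (0 : ℝ) ∈ Set.Icc 0 Real.pi := ⟨le_rfl, by positivity⟩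
  refine false_of_twisted_circle_map hqcont (k := 2 * M) (by positivity) ?_ ?_ ?_
  · intro φ hφ
    rw [hq (0, φ) ⟨hz', hφ⟩ (c (0, 0) * Circle.exp (-(2 * φ))), hclamp _ ⟨hz', hz⟩, mul_pow,
      ← Circle.exp_natCast_mul]
    · congr 2; ring
    · intro x
      rw [hzero₁, hzero₂, hc, flipC_rotC, rotC_flipC, ← Circle.exp_neg,
        mul_left_comm, ← Circle.exp_add]
      ring_nf
  · intro φ hφ
    rw [hq (Real.pi, φ) ⟨⟨hpos.le, le_rfl⟩, hφ⟩ (c (Real.pi, 0) * Circle.exp (2 * φ)),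
      hclamp _ ⟨⟨hpos.le, le_rfl⟩, hz⟩, mul_pow, ← Circle.exp_natCast_mul]
    · congr 2; ring
    · intro x
      rw [hpi₁, hpi₂, hc, flipC_rotC, rotC_flipC, ← Circle.exp_neg,
        mul_left_comm, ← Circle.exp_add]
      ring_nf
  · intro θ hθ
    rw [hclamp (θ, 0) ⟨hθ, hz⟩]
    refine hq _ ⟨hθ, by positivity, le_rfl⟩ _ fun x => ?_
    rw [hper₁, hper₂, hc]

/-! ### Orthonormal frames -/

/-- The point of the hyperplane `(b 2)^⊥` with coordinates `x`, where `ℂ` corresponds to the plane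
spanned by `b 0` and `b 1`, and the second coordinate is taken along `b 3`. -/
def hyperplanePoint (b : OrthonormalBasis (Fin 4) ℝ E4) (x : ℂ × ℝ) : E4 :=
  x.1.re • b 0 + x.1.im • b 1 + x.2 • b 3

section HyperplanePoint

variable (b : OrthonormalBasis (Fin 4) ℝ E4)

theorem hyperplanePoint_add (x y : ℂ × ℝ) :
    hyperplanePoint b (x + y) = hyperplanePoint b x + hyperplanePoint b y := by
  simp only [hyperplanePoint, Prod.fst_add, Prod.snd_add, Complex.add_re, Complex.add_im]
  module

theorem hyperplanePoint_smul (t : ℝ) (x : ℂ × ℝ) :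
    hyperplanePoint b (t • x) = t • hyperplanePoint b x := by
  simp only [hyperplanePoint, Prod.smul_fst, Prod.smul_snd, Complex.smul_re, Complex.smul_im,
    smul_eq_mul]
  module

theorem hyperplanePoint_sub (x y : ℂ × ℝ) :
    hyperplanePoint b (x - y) = hyperplanePoint b x - hyperplanePoint b y := by
  rw [eq_sub_iff_add_eq, ← hyperplanePoint_add, sub_add_cancel]

theorem hyperplanePoint_snd (s : ℝ) : hyperplanePoint b (0, s) = s • b 3 := by
  simp [hyperplanePoint]

theorem inner_hyperplanePoint_zero (x : ℂ × ℝ) : ⟪b 0, hyperplanePoint b x⟫ = x.1.re := by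
  simp [hyperplanePoint, inner_add_right, inner_smul_right, b.inner_eq_ite]

theorem inner_hyperplanePoint_one (x : ℂ × ℝ) : ⟪b 1, hyperplanePoint b x⟫ = x.1.im := by
  simp [hyperplanePoint, inner_add_right, inner_smul_right, b.inner_eq_ite]

theorem inner_hyperplanePoint_two (x : ℂ × ℝ) : ⟪b 2, hyperplanePoint b x⟫ = 0 := by
  simp [hyperplanePoint, inner_add_right, inner_smul_right, b.inner_eq_ite]

theorem inner_hyperplanePoint_three (x : ℂ × ℝ) : ⟪b 3, hyperplanePoint b x⟫ = x.2 := by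
  simp [hyperplanePoint, inner_add_right, inner_smul_right, b.inner_eq_ite]

theorem inner_hyperplanePoint_two' (x : ℂ × ℝ) : ⟪hyperplanePoint b x, b 2⟫ = 0 := by
  rw [real_inner_comm, inner_hyperplanePoint_two]

theorem norm_sq_hyperplanePoint (x : ℂ × ℝ) :
    ‖hyperplanePoint b x‖ ^ 2 = x.1.re ^ 2 + x.1.im ^ 2 + x.2 ^ 2 := by
  rw [← b.sum_sq_norm_inner_right]
  simp [Fin.sum_univ_four, inner_hyperplanePoint_zero, inner_hyperplanePoint_one,
    inner_hyperplanePoint_two, inner_hyperplanePoint_three]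

theorem exists_hyperplanePoint_eq {v : E4} (hv : ⟪v, b 2⟫ = 0) : ∃ x, hyperplanePoint b x = v := by
  refine ⟨(⟨⟪b 0, v⟫, ⟪b 1, v⟫⟩, ⟪b 3, v⟫), ?_⟩
  rw [real_inner_comm] at hv
  conv_rhs => rw [← b.sum_repr' v]
  simp [Fin.sum_univ_four, hyperplanePoint, hv]

end HyperplanePoint

/-- The spherical frame obtained from `b`: its third vector runs over the unit sphere of the span of
`b 0`, `b 1`, `b 2`, and its last vector is `b 3`. -/
def sphericalFrameVec (b : OrthonormalBasis (Fin 4) ℝ E4) (p : ℝ × ℝ) : Fin 4 → E4 :=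
  ![(Real.cos p.1 * Real.cos p.2) • b 0 + (Real.cos p.1 * Real.sin p.2) • b 1
      + (-Real.sin p.1) • b 2,
    (-Real.sin p.2) • b 0 + Real.cos p.2 • b 1,
    (Real.sin p.1 * Real.cos p.2) • b 0 + (Real.sin p.1 * Real.sin p.2) • b 1
      + Real.cos p.1 • b 2,
    b 3]

theorem orthonormal_sphericalFrameVec (b : OrthonormalBasis (Fin 4) ℝ E4) (p : ℝ × ℝ) :
    Orthonormal ℝ (sphericalFrameVec b p) := by
  have h1 := Real.sin_sq_add_cos_sq p.1
  have h2 := Real.sin_sq_add_cos_sq p.2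
  have h1' : Real.sin p.1 ^ 2 = 1 - Real.cos p.1 ^ 2 := by linarith
  have h2' : Real.sin p.2 ^ 2 = 1 - Real.cos p.2 ^ 2 := by linarith
  rw [orthonormal_iff_ite]
  intro i j
  fin_cases i <;> fin_cases j <;>
    simp [sphericalFrameVec, inner_add_right, inner_add_left, inner_smul_right, inner_smul_left,
      b.inner_eq_ite, -inner_self_eq_norm_sq_to_K] <;> ring_nf <;> try (simp only [h1', h2']; ring_nf)

/-- The spherical frame as an orthonormal basis. -/
def sphericalFrame (b : OrthonormalBasis (Fin 4) ℝ E4) (p : ℝ × ℝ) :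
    OrthonormalBasis (Fin 4) ℝ E4 :=
  OrthonormalBasis.mk (orthonormal_sphericalFrameVec b p) (by
    rw [(orthonormal_sphericalFrameVec b p).linearIndependent.span_eq_top_of_card_eq_finrank'
      (by simp)])

section SphericalFrame

variable (b : OrthonormalBasis (Fin 4) ℝ E4)

theorem sphericalFrame_apply (p : ℝ × ℝ) (i : Fin 4) :
    sphericalFrame b p i = sphericalFrameVec b p i := by
  simp [sphericalFrame]

theorem sphericalFrame_three (p : ℝ × ℝ) : sphericalFrame b p 3 = b 3 := by
  simp [sphericalFrame_apply, sphericalFrameVec]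

theorem sphericalFrame_zero_zero_two : sphericalFrame b (0, 0) 2 = b 2 := by
  simp [sphericalFrame_apply, sphericalFrameVec]

theorem hyperplanePoint_sphericalFrame (p : ℝ × ℝ) (x : ℂ × ℝ) :
    hyperplanePoint (sphericalFrame b p) x =
      (x.1.re * (Real.cos p.1 * Real.cos p.2) - x.1.im * Real.sin p.2) • b 0 +
      (x.1.re * (Real.cos p.1 * Real.sin p.2) + x.1.im * Real.cos p.2) • b 1 +
      (-(x.1.re * Real.sin p.1)) • b 2 + x.2 • b 3 := by
  simp only [hyperplanePoint, sphericalFrame_apply, sphericalFrameVec, Matrix.cons_val]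
  module

theorem continuous_hyperplanePoint_sphericalFrame :
    Continuous fun q : (ℝ × ℝ) × (ℂ × ℝ) => hyperplanePoint (sphericalFrame b q.1) q.2 := by
  simp only [hyperplanePoint_sphericalFrame]
  fun_prop

theorem hyperplanePoint_sphericalFrame_zero (φ : ℝ) (x : ℂ × ℝ) :
    hyperplanePoint (sphericalFrame b (0, φ)) x =
      hyperplanePoint (sphericalFrame b (0, 0)) (rotC (Circle.exp φ) x) := by
  simp only [hyperplanePoint_sphericalFrame, rotC, Circle.coe_exp, Complex.mul_re, Complex.mul_im,
    Complex.exp_ofReal_mul_I_re, Complex.exp_ofReal_mul_I_im, Real.cos_zero, Real.sin_zero]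
  module

theorem hyperplanePoint_sphericalFrame_pi (φ : ℝ) (x : ℂ × ℝ) :
    hyperplanePoint (sphericalFrame b (Real.pi, φ)) x =
      hyperplanePoint (sphericalFrame b (Real.pi, 0)) (rotC (Circle.exp (-φ)) x) := by
  simp only [hyperplanePoint_sphericalFrame, rotC, Circle.coe_exp, Complex.mul_re, Complex.mul_im,
    Complex.exp_ofReal_mul_I_re, Complex.exp_ofReal_mul_I_im, Real.cos_pi, Real.sin_pi,
    Real.cos_zero, Real.sin_zero, Real.cos_neg, Real.sin_neg]
  module

theorem hyperplanePoint_sphericalFrame_two_pi (θ : ℝ) (x : ℂ × ℝ) :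
    hyperplanePoint (sphericalFrame b (θ, 2 * Real.pi)) x =
      hyperplanePoint (sphericalFrame b (θ, 0)) x := by
  simp [hyperplanePoint_sphericalFrame]

theorem norm_hyperplanePoint_eq (b b' : OrthonormalBasis (Fin 4) ℝ E4) (x : ℂ × ℝ) :
    ‖hyperplanePoint b x‖ = ‖hyperplanePoint b' x‖ := by
  rw [← sq_eq_sq₀ (norm_nonneg _) (norm_nonneg _), norm_sq_hyperplanePoint,
    norm_sq_hyperplanePoint]

/-- A direction off the line of `b 3` is orthogonal to few vectors of the sphere. -/
theorem dense_inner_sphericalFrame_two_ne_zero {v : E4} (hv : ∀ t : ℝ, v ≠ t • b 3) :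
    Dense {p : ℝ × ℝ | ⟪v, sphericalFrame b p 2⟫ ≠ 0} := by
  have hform : ∀ p, ⟪v, sphericalFrame b p 2⟫ = Real.sin p.1 * Real.cos p.2 * ⟪v, b 0⟫ +
      Real.sin p.1 * Real.sin p.2 * ⟪v, b 1⟫ + Real.cos p.1 * ⟪v, b 2⟫ := by
    intro p
    simp [sphericalFrame_apply, sphericalFrameVec, inner_add_right, inner_smul_right]
  have han : AnalyticOnNhd ℝ (fun p : ℝ × ℝ => Real.sin p.1 * Real.cos p.2 * ⟪v, b 0⟫ +
      Real.sin p.1 * Real.sin p.2 * ⟪v, b 1⟫ + Real.cos p.1 * ⟪v, b 2⟫) Set.univ := by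
    intro p _
    have hfst : AnalyticAt ℝ (fun p : ℝ × ℝ => p.1) p := analyticAt_fst
    have hsnd : AnalyticAt ℝ (fun p : ℝ × ℝ => p.2) p := analyticAt_snd
    fun_prop
  have hcompl : {p : ℝ × ℝ | ⟪v, sphericalFrame b p 2⟫ ≠ 0} =
      {p : ℝ × ℝ | ⟪v, sphericalFrame b p 2⟫ = 0}ᶜ := rfl
  rw [hcompl, ← interior_eq_empty_iff_dense_compl, Set.eq_empty_iff_forall_notMem]
  intro p hp
  have hzero := han.eqOn_zero_of_preconnected_of_eventuallyEq_zero isPreconnected_univ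
    (Set.mem_univ p) (by
      filter_upwards [mem_interior_iff_mem_nhds.1 hp] with p' hp'
      have : ⟪v, sphericalFrame b p' 2⟫ = 0 := hp'
      rwa [hform] at this)
  have e2 := hzero (Set.mem_univ (0, 0))
  have e0 := hzero (Set.mem_univ (Real.pi / 2, 0))
  have e1 := hzero (Set.mem_univ (Real.pi / 2, Real.pi / 2))
  simp at e0 e1 e2
  refine hv ⟪b 3, v⟫ ?_
  conv_lhs => rw [← b.sum_repr' v]
  simp [Fin.sum_univ_four, real_inner_comm, e0, e1, e2]

theorem dense_forall_inner_sphericalFrame_two {D : Set E4} (hD : D.Countable) :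
    Dense {p : ℝ × ℝ | ∀ v ∈ D, ⟪v, sphericalFrame b p 2⟫ = 0 → ∃ t : ℝ, v = t • b 3} := by
  have hD' : {v ∈ D | ∀ t : ℝ, v ≠ t • b 3}.Countable := hD.mono (Set.sep_subset _ _)
  refine (dense_biInter_of_isOpen (f := fun v => {p : ℝ × ℝ | ⟪v, sphericalFrame b p 2⟫ ≠ 0})
    (fun v hv => ?_) hD' fun v hv => dense_inner_sphericalFrame_two_ne_zero b hv.2).mono ?_
  · refine isOpen_ne_fun ?_ continuous_const
    simp only [sphericalFrame_apply, sphericalFrameVec, Matrix.cons_val]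
    fun_prop
  · intro p hp v hv h0
    by_contra! hne
    exact Set.mem_iInter₂.1 hp v ⟨hv, hne⟩ h0

end SphericalFrame

/-! ### Sections of star bodies -/

theorem StarShapedO.zero_mem {K : Set E4} (hK : StarShapedO K) (hne : K.Nonempty) :
    (0 : E4) ∈ K := by
  obtain ⟨x, hx⟩ := hne
  simpa using hK x hx 0 (by simp)

theorem IsStarBody.zero_mem {K : Set E4} (hK : IsStarBody K) : (0 : E4) ∈ K :=
  hK.2.1.zero_mem (hK.1.2.1.mono interior_subset)

theorem IsStarBody.isCompact_radial {K : Set E4} (hK : IsStarBody K) {θ : E4} (hθ : θ ∈ sph) :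
    IsCompact {c : ℝ | c • θ ∈ K} := by
  have hθ1 : ‖θ‖ = 1 := by simpa [sph] using hθ
  obtain ⟨R, hR⟩ := hK.1.1.isBounded.exists_norm_le
  refine Metric.isCompact_of_isClosed_isBounded
    (hK.1.1.isClosed.preimage (by fun_prop : Continuous fun c : ℝ => c • θ)) ?_
  refine isBounded_iff_forall_norm_le.2 ⟨R, fun c hc => ?_⟩
  simpa [norm_smul, hθ1] using hR _ hc

theorem IsStarBody.le_radialFn {K : Set E4} (hK : IsStarBody K) {θ : E4} (hθ : θ ∈ sph) {t : ℝ}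
    (ht : t • θ ∈ K) : t ≤ radialFn K θ :=
  le_csSup (hK.isCompact_radial hθ).bddAbove ht

theorem IsStarBody.smul_mem {K : Set E4} (hK : IsStarBody K) {θ : E4} (hθ : θ ∈ sph) {t : ℝ}
    (ht0 : 0 ≤ t) (ht : t ≤ radialFn K θ) : t • θ ∈ K := by
  have hmem : radialFn K θ • θ ∈ K :=
    (hK.isCompact_radial hθ).sSup_mem ⟨0, by simpa using hK.zero_mem⟩
  rcases ht0.eq_or_lt with rfl | hpos
  · simpa using hK.zero_mem
  · have := hK.2.1 _ hmem (t / radialFn K θ)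
      ⟨div_nonneg ht0 (ht0.trans ht), div_le_one_of_le₀ ht (ht0.trans ht)⟩
    rwa [smul_smul, div_mul_cancel₀ _ (hpos.trans_le ht).ne'] at this

/-- The sections of a translated star body by a continuous family of hyperplanes vary
continuously. -/
theorem IsStarBody.isContinuousFamily {K : Set E4} (hK : IsStarBody K)
    (b : OrthonormalBasis (Fin 4) ℝ E4) (s : ℝ) :
    IsContinuousFamily fun p : ℝ × ℝ =>
      {x : ℂ × ℝ | hyperplanePoint (sphericalFrame b p) (x - (0, s)) ∈ K} := by
  have hcont := continuous_hyperplanePoint_sphericalFrame b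
  refine ⟨hK.1.1.isClosed.preimage
    (hcont.comp (continuous_fst.prodMk (continuous_snd.sub continuous_const))), ?_⟩
  intro p x hx
  obtain ⟨y, rfl⟩ : ∃ y, x = y + (0, s) := ⟨x - (0, s), by simp⟩
  simp only [Set.mem_ofPred_eq, add_sub_cancel_right] at hx
  set r := ‖hyperplanePoint b y‖ with hr
  have hnorm : ∀ p', ‖hyperplanePoint (sphericalFrame b p') y‖ = r :=
    fun p' => norm_hyperplanePoint_eq _ _ _
  by_cases hr0 : r = 0
  · refine ⟨fun _ => y + (0, s), continuousAt_const, rfl, fun p' => ?_⟩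
    have h0 : hyperplanePoint (sphericalFrame b p') y = 0 := norm_eq_zero.1 ((hnorm p').trans hr0)
    simpa [h0] using hK.zero_mem
  have hrpos : 0 < r := lt_of_le_of_ne (norm_nonneg _) (Ne.symm hr0)
  set θ : ℝ × ℝ → E4 := fun p' => r⁻¹ • hyperplanePoint (sphericalFrame b p') y with hθ
  have hθs : ∀ p', θ p' ∈ sph := by
    intro p'
    simp [sph, hθ, norm_smul, hnorm, abs_of_pos hrpos, hr0]
  have hθr : ∀ p', hyperplanePoint (sphericalFrame b p') y = r • θ p' := by
    intro p'
    rw [hθ, smul_smul, mul_inv_cancel₀ hr0, one_smul]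
  have hθc : Continuous θ := by
    have : Continuous fun p' => hyperplanePoint (sphericalFrame b p') y :=
      hcont.comp (continuous_id.prodMk continuous_const)
    fun_prop
  have hρ : Continuous fun p' => radialFn K (θ p') := hK.2.2.comp_continuous hθc hθs
  refine ⟨fun p' => (min 1 (radialFn K (θ p') / r)) • y + (0, s), ?_, ?_, ?_⟩
  · exact Continuous.continuousAt (by fun_prop)
  · have : r ≤ radialFn K (θ p) := hK.le_radialFn (hθs p) (by rwa [← hθr])
    have : 1 ≤ radialFn K (θ p) / r := by rwa [le_div_iff₀ hrpos, one_mul]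
    simp [min_eq_left this]
  · intro p'
    have h0 : 0 ≤ radialFn K (θ p') := hK.le_radialFn (hθs p') (by simpa using hK.zero_mem)
    simp only [Set.mem_ofPred_eq, add_sub_cancel_right, hyperplanePoint_smul, hθr, smul_smul]
    refine hK.smul_mem (hθs p') (by positivity) ?_
    calc _ ≤ radialFn K (θ p') / r * r := by gcongr; exact min_le_right _ _
      _ = _ := by field_simp

/-! ### Rotations of a hyperplane -/

/-- The half-turn whose axis is the plane spanned by `u` and `w`. -/
def halfTurn (u w : E4) : E4 ≃ₗᵢ[ℝ] E4 := (Submodule.span ℝ {u, w}).reflection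

section HalfTurn

variable {u w : E4}

theorem halfTurn_left : halfTurn u w u = u :=
  Submodule.reflection_mem_subspace_eq_self (Submodule.subset_span (by simp))

theorem halfTurn_right : halfTurn u w w = w :=
  Submodule.reflection_mem_subspace_eq_self (Submodule.subset_span (by simp))

theorem halfTurn_of_orthogonal {v : E4} (hu : ⟪v, u⟫ = 0) (hw : ⟪v, w⟫ = 0) :
    halfTurn u w v = -v := by
  refine Submodule.reflection_mem_subspace_orthogonalComplement_eq_neg ?_
  rw [Submodule.mem_orthogonal]
  intro x hx
  obtain ⟨s, t, rfl⟩ := Submodule.mem_span_pair.1 hx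
  rw [inner_add_left, inner_smul_left, inner_smul_left, real_inner_comm, hu, real_inner_comm, hw]
  simp

theorem isRot_halfTurn (h : Orthonormal ℝ ![u, w]) : IsRot w (halfTurn u w) := by
  refine ⟨halfTurn_right, ?_⟩
  have h2 : Module.finrank ℝ (Submodule.span ℝ {u, w}) = 2 := by
    have := finrank_span_eq_card h.linearIndependent
    rw [Matrix.range_cons_cons_empty] at this
    simpa using this
  have hperp : Module.finrank ℝ (Submodule.span ℝ {u, w})ᗮ = 2 := by
    have := (Submodule.span ℝ {u, w}).finrank_add_finrank_orthogonal
    rw [h2, finrank_euclideanSpace_fin] at this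
    omega
  have := (Submodule.span ℝ {u, w}).det_reflection
  rw [hperp] at this
  refine Eq.trans ?_ (this.trans (by norm_num))
  rfl

theorem isRotAngleAbout_halfTurn (h : Orthonormal ℝ ![u, w]) :
    IsRotAngleAbout w u 1 (halfTurn u w) := by
  refine ⟨isRot_halfTurn h, halfTurn_left, fun v hw hu => ?_⟩
  rw [halfTurn_of_orthogonal hu hw]
  simp

end HalfTurn

theorem IsRot.trans {w : E4} {φ ψ : E4 ≃ₗᵢ[ℝ] E4} (hφ : IsRot w φ) (hψ : IsRot w ψ) :
    IsRot w (φ.trans ψ) := by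
  refine ⟨by simp [hφ.1, hψ.1], ?_⟩
  have := LinearMap.det_comp (ψ.toLinearEquiv : E4 →ₗ[ℝ] E4) (φ.toLinearEquiv : E4 →ₗ[ℝ] E4)
  rw [hφ.2, hψ.2, one_mul] at this
  exact this

section RotationsInFrames

variable (b : OrthonormalBasis (Fin 4) ℝ E4)

theorem orthonormal_three_two : Orthonormal ℝ ![b 3, b 2] := by
  simp [b.inner_eq_ite]

theorem norm_hyperplanePoint_circle (d : Circle) : ‖hyperplanePoint b (d, 0)‖ = 1 := by
  have h := norm_sq_hyperplanePoint b (d, 0)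
  have hd : (d : ℂ).re ^ 2 + (d : ℂ).im ^ 2 = 1 := by
    have := Circle.normSq_coe d
    rw [Complex.normSq_apply] at this
    linarith
  simp only [hd] at h
  have := norm_nonneg (hyperplanePoint b (d, 0))
  nlinarith

theorem orthonormal_circle_two (d : Circle) : Orthonormal ℝ ![hyperplanePoint b (d, 0), b 2] := by
  simp [norm_hyperplanePoint_circle, inner_hyperplanePoint_two']

theorem inner_hyperplanePoint (x y : ℂ × ℝ) : ⟪hyperplanePoint b x, hyperplanePoint b y⟫ =
    x.1.re * y.1.re + x.1.im * y.1.im + x.2 * y.2 := by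
  conv_lhs => enter [2]; rw [hyperplanePoint]
  simp only [inner_add_left, inner_smul_left, inner_hyperplanePoint_zero,
    inner_hyperplanePoint_one, inner_hyperplanePoint_three]
  simp

theorem halfTurn_three_hyperplanePoint {c : Circle} (hc : (c : ℂ) = -1) (x : ℂ × ℝ) :
    halfTurn (b 3) (b 2) (hyperplanePoint b x) = hyperplanePoint b (rotC c x) := by
  have hx : x = (x.1, 0) + (0, x.2) := by simp
  have h1 : halfTurn (b 3) (b 2) (hyperplanePoint b (x.1, 0)) = - hyperplanePoint b (x.1, 0) :=
    halfTurn_of_orthogonal (by rw [real_inner_comm, inner_hyperplanePoint_three])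
      (inner_hyperplanePoint_two' _ _)
  conv_lhs => rw [hx, hyperplanePoint_add, map_add, h1, hyperplanePoint_snd, map_smul, halfTurn_left]
  simp [hyperplanePoint, rotC, hc]
  module

theorem halfTurn_circle_hyperplanePoint (d : Circle) (x : ℂ × ℝ) :
    halfTurn (hyperplanePoint b (d, 0)) (b 2) (hyperplanePoint b x) =
      hyperplanePoint b (flipC 0 (d * d) x) := by
  have hd : (d : ℂ).re * (d : ℂ).re + (d : ℂ).im * (d : ℂ).im = 1 := by
    rw [← Complex.normSq_apply, Circle.normSq_coe]
  set t : ℝ := (d : ℂ).re * x.1.re + (d : ℂ).im * x.1.im with ht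
  have hx : x = t • ((d : ℂ), (0 : ℝ)) + (x - t • ((d : ℂ), (0 : ℝ))) := by simp
  have h1 := halfTurn_of_orthogonal (u := hyperplanePoint b (d, 0)) (w := b 2)
    (v := hyperplanePoint b (x - t • ((d : ℂ), (0 : ℝ)))) (by
      rw [inner_hyperplanePoint]
      simp
      linear_combination (-t) * hd - ht) (inner_hyperplanePoint_two' _ _)
  conv_lhs => rw [hx, hyperplanePoint_add, map_add, h1, hyperplanePoint_smul, map_smul,
    halfTurn_left, ← hyperplanePoint_smul, ← sub_eq_add_neg, ← hyperplanePoint_sub]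
  congr 1
  refine Prod.ext (Complex.ext ?_ ?_) ?_
  · simp [flipC]
    rw [ht]
    linear_combination (x.1.re) * hd
  · simp [flipC]
    rw [ht]
    linear_combination (x.1.im) * hd
  · simp [flipC]

theorem Circle.exists_mul_self_eq (c : Circle) : ∃ d : Circle, d * d = c := by
  obtain ⟨t, rfl⟩ := Circle.exp_surjective c
  exact ⟨Circle.exp (t / 2), by rw [← Circle.exp_add]; ring_nf⟩

theorem exists_isRot_eq_rotC (c : Circle) : ∃ φ : E4 ≃ₗᵢ[ℝ] E4, IsRot (b 2) φ ∧
    ∀ x, φ (hyperplanePoint b x) = hyperplanePoint b (rotC c x) := by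
  obtain ⟨d, rfl⟩ := Circle.exists_mul_self_eq c
  refine ⟨(halfTurn (hyperplanePoint b ((1 : Circle), 0)) (b 2)).trans
    (halfTurn (hyperplanePoint b (d, 0)) (b 2)),
    (isRot_halfTurn (orthonormal_circle_two b 1)).trans
      (isRot_halfTurn (orthonormal_circle_two b d)), fun x => ?_⟩
  rw [LinearIsometryEquiv.trans_apply, halfTurn_circle_hyperplanePoint,
    halfTurn_circle_hyperplanePoint, flipC_flipC]
  simp

/-- A rotation of the hyperplane `(b 2)^⊥` preserving the line of `b 3` acts on the plane of
`b 0`, `b 1` by an explicit matrix. -/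
theorem IsRot.exists_circle {φ : E4 ≃ₗᵢ[ℝ] E4} (hφ : IsRot (b 2) φ) {ε : ℝ} (hε : ε * ε = 1)
    (h3 : φ (b 3) = ε • b 3) :
    ∃ c : Circle, φ (b 0) = (c : ℂ).re • b 0 + (c : ℂ).im • b 1 ∧
      φ (b 1) = (-(ε * (c : ℂ).im)) • b 0 + (ε * (c : ℂ).re) • b 1 := by
  have hin : ∀ i j, ⟪φ (b i), φ (b j)⟫ = if i = j then (1 : ℝ) else 0 := fun i j => by
    rw [φ.inner_map_map, b.inner_eq_ite]
  have hε0 : ε ≠ 0 := by rintro rfl; simp at hε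
  have h3' : b 3 = ε • φ (b 3) := by rw [h3, smul_smul, hε, one_smul]
  have plane : ∀ i, i ≠ 2 → i ≠ 3 → ⟪b 2, φ (b i)⟫ = 0 ∧ ⟪b 3, φ (b i)⟫ = 0 := by
    intro i h2i h3i
    constructor
    · conv_lhs => enter [2]; rw [← hφ.1]
      rw [hin, if_neg h2i.symm]
    · rw [h3', inner_smul_left, hin, if_neg h3i.symm, mul_zero]
  have exp : ∀ i, i ≠ 2 → i ≠ 3 → φ (b i) = ⟪b 0, φ (b i)⟫ • b 0 + ⟪b 1, φ (b i)⟫ • b 1 := by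
    intro i h2i h3i
    conv_lhs => rw [← b.sum_repr' (φ (b i))]
    simp [Fin.sum_univ_four, plane i h2i h3i]
  have e0 := exp 0 (by decide) (by decide)
  have e1 := exp 1 (by decide) (by decide)
  set α := ⟪b 0, φ (b 0)⟫
  set β := ⟪b 1, φ (b 0)⟫
  set γ := ⟪b 0, φ (b 1)⟫
  set δ := ⟪b 1, φ (b 1)⟫
  have n0 : α * α + β * β = 1 := by
    have := hin 0 0
    rw [e0] at this
    simpa [inner_add_right, inner_add_left, inner_smul_right, inner_smul_left,
      b.inner_eq_ite, -inner_self_eq_norm_sq_to_K] using this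
  have n1 : γ * γ + δ * δ = 1 := by
    have := hin 1 1
    rw [e1] at this
    simpa [inner_add_right, inner_add_left, inner_smul_right, inner_smul_left,
      b.inner_eq_ite, -inner_self_eq_norm_sq_to_K] using this
  have hdet : ε * (α * δ - β * γ) = 1 := by
    have hd := hφ.2
    rw [← LinearMap.det_toMatrix b.toBasis] at hd
    have hM : LinearMap.toMatrix b.toBasis b.toBasis (φ.toLinearEquiv : E4 →ₗ[ℝ] E4) =
        !![α, γ, 0, 0; β, δ, 0, 0; 0, 0, 1, 0; 0, 0, 0, ε] := by
      ext i j
      have : LinearMap.toMatrix b.toBasis b.toBasis (φ.toLinearEquiv : E4 →ₗ[ℝ] E4) i j =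
          ⟪b i, φ (b j)⟫ := by
        simp [LinearMap.toMatrix_apply, OrthonormalBasis.repr_apply_apply]
      rw [this]
      fin_cases j
      · simp only [Fin.zero_eta, e0]
        fin_cases i <;> simp [inner_add_right, inner_smul_right, b.inner_eq_ite]
      · simp only [Fin.mk_one, e1]
        fin_cases i <;> simp [inner_add_right, inner_smul_right, b.inner_eq_ite]
      · simp only [Fin.reduceFinMk, hφ.1]
        fin_cases i <;> simp [b.inner_eq_ite]
      · simp only [Fin.reduceFinMk, h3]
        fin_cases i <;> simp [inner_smul_right, b.inner_eq_ite]
    rw [hM] at hd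
    simp [Matrix.det_succ_row_zero, Fin.sum_univ_succ, Fin.succAbove] at hd
    linear_combination hd
  have hsq : (γ + ε * β) ^ 2 + (δ - ε * α) ^ 2 = 0 := by
    linear_combination n1 + (ε * ε) * n0 - 2 * hdet + hε
  have hγ : γ = -(ε * β) := by nlinarith [sq_nonneg (γ + ε * β), sq_nonneg (δ - ε * α)]
  have hδ : δ = ε * α := by nlinarith [sq_nonneg (γ + ε * β), sq_nonneg (δ - ε * α)]
  refine ⟨⟨⟨α, β⟩, ?_⟩, ?_, ?_⟩
  · rw [Submonoid.unitSphere, Submonoid.mem_mk, Subsemigroup.mem_mk, mem_sphere_zero_iff_norm,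
      ← sq_eq_sq₀ (norm_nonneg _) zero_le_one, ← Complex.normSq_eq_norm_sq, Complex.normSq_apply]
    simpa using n0
  · exact e0
  · rw [← hγ, ← hδ]; exact e1

theorem IsRot.exists_rotC {φ : E4 ≃ₗᵢ[ℝ] E4} (hφ : IsRot (b 2) φ) (h3 : φ (b 3) = b 3) :
    ∃ c, ∀ x, φ (hyperplanePoint b x) = hyperplanePoint b (rotC c x) := by
  obtain ⟨c, h0, h1⟩ := hφ.exists_circle b (ε := 1) (by norm_num) (by simpa using h3)
  refine ⟨c, fun x => ?_⟩
  simp only [hyperplanePoint, map_add, map_smul, h0, h1, h3, rotC, Complex.mul_re, Complex.mul_im]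
  module

theorem IsRot.exists_flipC {φ : E4 ≃ₗᵢ[ℝ] E4} (hφ : IsRot (b 2) φ) (h3 : φ (b 3) = -b 3) :
    ∃ c, ∀ x, φ (hyperplanePoint b x) = hyperplanePoint b (flipC 0 c x) := by
  obtain ⟨c, h0, h1⟩ := hφ.exists_circle b (ε := -1) (by norm_num) (by simpa using h3)
  refine ⟨c, fun x => ?_⟩
  simp only [hyperplanePoint, map_add, map_smul, h0, h1, h3, flipC, Complex.mul_re,
    Complex.mul_im, Complex.conj_re, Complex.conj_im]
  module

end RotationsInFrames

/-! ### Diameters -/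

theorem StarShapedO.segment_smul_subset {K : Set E4} (hK : StarShapedO K) {ζ : E4} {r t : ℝ}
    (hr : r • ζ ∈ K) (ht : t • ζ ∈ K) : segment ℝ (r • ζ) (t • ζ) ⊆ K := by
  have key : ∀ q q' : ℝ, q • ζ ∈ K → q' ∈ Set.uIcc 0 q → q' • ζ ∈ K := by
    intro q q' hq hq'
    rw [← segment_eq_uIcc, segment_eq_image] at hq'
    obtain ⟨c, hc, rfl⟩ := hq'
    simpa [smul_smul] using hK _ hq c hc
  rintro x ⟨α, β, hα, hβ, hαβ, rfl⟩
  rw [smul_smul, smul_smul, ← add_smul]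
  have hmem : α * r + β * t ∈ Set.uIcc r t := by
    rw [← segment_eq_uIcc]
    exact ⟨α, β, hα, hβ, hαβ, rfl⟩
  have : α * r + β * t ∈ Set.uIcc 0 r ∨ α * r + β * t ∈ Set.uIcc 0 t := by
    rw [Set.uIcc_comm 0 r]
    exact Set.uIcc_subset_uIcc_union_uIcc hmem
  exact this.elim (key _ _ hr) (key _ _ ht)

theorem dist_le_chordSup {K : Set E4} (hK : Bornology.IsBounded K) {z y : E4}
    (h : segment ℝ z y ⊆ K) : dist z y ≤ chordSup K := by
  refine le_csSup ⟨Metric.diam K, ?_⟩ ⟨z, y, h, rfl⟩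
  rintro _ ⟨z', y', h', rfl⟩
  exact Metric.dist_le_diam_of_mem hK (h' (left_mem_segment ℝ z' y'))
    (h' (right_mem_segment ℝ z' y'))

theorem segment_subset_image_add_right_iff {K : Set E4} {a z y : E4} :
    segment ℝ z y ⊆ (fun x => x + a) '' K ↔ segment ℝ (z - a) (y - a) ⊆ K := by
  rw [Set.image_add_right, ← Set.image_subset_iff]
  have : (fun x => x + -a) '' segment ℝ z y = segment ℝ (z - a) (y - a) := by
    simpa [add_comm, sub_eq_add_neg] using segment_translate_image ℝ (-a) z y
  rw [this]

theorem chordSup_image_add_right (K : Set E4) (a : E4) :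
    chordSup ((fun x => x + a) '' K) = chordSup K := by
  refine congrArg sSup (Set.ext fun d => ⟨?_, ?_⟩)
  · rintro ⟨z, y, h, rfl⟩
    exact ⟨z - a, y - a, segment_subset_image_add_right_iff.1 h, by simp⟩
  · rintro ⟨z, y, h, rfl⟩
    exact ⟨z + a, y + a, segment_subset_image_add_right_iff.2 (by simpa using h), by simp⟩

theorem CountablyManyDiamsStar.image_add_right {K : Set E4} (hK : CountablyManyDiamsStar K)
    (a : E4) : CountablyManyDiamsStar ((fun x => x + a) '' K) := by
  refine (Set.Countable.image hK fun p => (p.1 + a, p.2 + a)).mono ?_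
  rintro ⟨z, y⟩ ⟨hsub, hdist⟩
  exact ⟨(z - a, y - a), ⟨segment_subset_image_add_right_iff.1 hsub,
    by rw [← chordSup_image_add_right K a]; simpa using hdist⟩, by simp⟩

/-- The endpoints of the diameters of `K`. -/
def diamEndpoints (K : Set E4) : Set E4 := {v | ∃ y, IsDiamStar K v y ∨ IsDiamStar K y v}

theorem CountablyManyDiamsStar.countable_diamEndpoints {K : Set E4}
    (hK : CountablyManyDiamsStar K) : (diamEndpoints K).Countable := by
  refine ((Set.Countable.image hK Prod.fst).union (Set.Countable.image hK Prod.snd)).mono ?_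
  rintro v ⟨y, h | h⟩
  · exact Or.inl ⟨(v, y), h, rfl⟩
  · exact Or.inr ⟨(y, v), h, rfl⟩

theorem inner_map_eq_of_map_eq {w v : E4} {φ : E4 ≃ₗᵢ[ℝ] E4} (hφ : φ w = w) :
    ⟪φ v, w⟫ = ⟪v, w⟫ := by
  conv_lhs => rw [← hφ]
  rw [φ.inner_map_map]

theorem abs_sub_extremal {r t r' t' : ℝ} (heq : |r' - t'| = |r - t|) (h1 : |r' - r| ≤ |r - t|)
    (h2 : |r' - t| ≤ |r - t|) (h3 : |t' - r| ≤ |r - t|) (h4 : |t' - t| ≤ |r - t|) :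
    (r' = r ∧ t' = t) ∨ (r' = t ∧ t' = r) := by
  wlog h : r ≤ t generalizing r t
  · rw [abs_sub_comm r t] at heq h1 h2 h3 h4
    have := this heq h2 h1 h4 h3 (le_of_not_ge h)
    tauto
  rw [abs_sub_comm r t, abs_of_nonneg (sub_nonneg.2 h)] at *
  rw [abs_le] at h1 h2 h3 h4
  rcases abs_cases (r' - t') with ⟨h5, h6⟩ | ⟨h5, h6⟩
  · right; constructor <;> linarith
  · left; constructor <;> linarith

/-- A rigid motion matching two hyperplane sections preserves a common diameter, provided that the
hyperplane contains no diameter of the second body off the line of that diameter. -/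
theorem IsDiamStar.map_eq_or_eq_neg {K M : Set E4} {w ζ d : E4} {φ : E4 ≃ₗᵢ[ℝ] E4} {r t : ℝ}
    (hM : Bornology.IsBounded M) (hMs : StarShapedO M) (hζ : ‖ζ‖ = 1) (hζw : ⟪ζ, w⟫ = 0)
    (hφw : φ w = w) (hd : ⟪d, w⟫ = 0)
    (hφ : ∀ v, ⟪v, w⟫ = 0 → (v ∈ K ↔ φ v + d ∈ M)) (hrt : r ≠ t)
    (hdK : IsDiamStar K (r • ζ) (t • ζ)) (hdM : IsDiamStar M (r • ζ) (t • ζ))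
    (hD : ∀ v ∈ diamEndpoints M, ⟪v, w⟫ = 0 → ∃ q : ℝ, v = q • ζ) :
    (φ ζ = ζ ∧ d = 0) ∨ (φ ζ = -ζ ∧ d = (r + t) • ζ) := by
  have horth : ∀ q : ℝ, ⟪q • ζ, w⟫ = 0 := fun q => by rw [real_inner_smul_left, hζw, mul_zero]
  have horth' : ∀ q : ℝ, ⟪φ (q • ζ) + d, w⟫ = 0 := fun q => by
    rw [inner_add_left, hd, add_zero, inner_map_eq_of_map_eq hφw, horth]
  have hdist : ∀ p q : ℝ, dist (p • ζ) (q • ζ) = |p - q| := fun p q => by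
    rw [dist_eq_norm, ← sub_smul, norm_smul, hζ, mul_one, Real.norm_eq_abs]
  have hdiam : IsDiamStar M (φ (r • ζ) + d) (φ (t • ζ) + d) := by
    refine ⟨?_, ?_⟩
    · rintro _ ⟨α, β, hα, hβ, hαβ, rfl⟩
      have hx := hdK.1 ⟨α, β, hα, hβ, hαβ, rfl⟩
      have hw : ⟪α • r • ζ + β • t • ζ, w⟫ = 0 := by
        rw [smul_smul, smul_smul, ← add_smul, horth]
      rw [hφ _ hw] at hx
      convert hx using 1
      simp only [map_add, map_smul]
      linear_combination (norm := module) hαβ • d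
    · rw [dist_add_right, φ.dist_map, hdist, ← hdist, hdM.2]
  obtain ⟨r', hr'⟩ := hD _ ⟨_, Or.inl hdiam⟩ (horth' r)
  obtain ⟨t', ht'⟩ := hD _ ⟨_, Or.inr hdiam⟩ (horth' t)
  rw [hr', ht'] at hdiam
  have hle : ∀ p q : ℝ, p • ζ ∈ M → q • ζ ∈ M → |p - q| ≤ |r - t| := fun p q hp hq => by
    rw [← hdist, ← hdist, hdM.2]
    exact dist_le_chordSup hM (hMs.segment_smul_subset hp hq)
  have hrM := hdM.1 (left_mem_segment ℝ _ _)
  have htM := hdM.1 (right_mem_segment ℝ _ _)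
  have hrM' := hdiam.1 (left_mem_segment ℝ _ _)
  have htM' := hdiam.1 (right_mem_segment ℝ _ _)
  have heq : |r' - t'| = |r - t| := by rw [← hdist, ← hdist, hdM.2, hdiam.2]
  have hcases := abs_sub_extremal heq (hle _ _ hrM' hrM) (hle _ _ hrM' htM) (hle _ _ htM' hrM)
    (hle _ _ htM' htM)
  have hne : r - t ≠ 0 := sub_ne_zero.2 hrt
  have hsub : (r - t) • φ ζ = (r' - t') • ζ := by
    rw [sub_smul, sub_smul, ← hr', ← ht', map_smul, map_smul]
    abel
  rcases hcases with ⟨rfl, rfl⟩ | ⟨rfl, rfl⟩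
  · have h := smul_right_injective E4 hne hsub
    refine Or.inl ⟨h, ?_⟩
    rwa [map_smul, h, add_eq_left] at hr'
  · have h : φ ζ = -ζ := smul_right_injective E4 hne (hsub.trans (by module))
    refine Or.inr ⟨h, ?_⟩
    rw [map_smul, h] at hr'
    rw [add_smul, ← hr']
    module

/-! ### Congruences of sections -/

theorem DirCong.exists_mem_iff {w : E4} {K L : Set E4} (h : DirCong w (sect w K) (sect w L))
    {a : E4} (ha : ⟪a, w⟫ = 0) : ∃ φ : E4 ≃ₗᵢ[ℝ] E4, IsRot w φ ∧ ∃ d : E4, ⟪d, w⟫ = 0 ∧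
      ∀ v, ⟪v, w⟫ = 0 → (v ∈ K ↔ φ v + d ∈ (fun x => x + a) '' L) := by
  obtain ⟨φ, hφ, b, hb, h⟩ := h
  refine ⟨φ, hφ, a - b, by rw [inner_sub_left, ha, hb, sub_zero], fun v hv => ⟨fun hvK => ?_, ?_⟩⟩
  · obtain ⟨l, hl, hlv⟩ : φ v ∈ (fun x => x + b) '' sect w L := h ▸ ⟨v, ⟨hvK, hv⟩, rfl⟩
    exact ⟨l, hl.1, by
      rw [← hlv]; module⟩
  · rintro ⟨l, hl, hlv⟩
    have hlv' : l + b = φ v := by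
      have : l + a = φ v + (a - b) := hlv
      rw [← sub_eq_zero] at this ⊢
      rw [← this]; abel
    have hlw : ⟪l, w⟫ = 0 := by
      rw [eq_sub_of_add_eq hlv', inner_sub_left, hb, inner_map_eq_of_map_eq hφ.1, hv, sub_zero]
    obtain ⟨k, hk, hkv⟩ : φ v ∈ φ '' sect w K := h ▸ ⟨l, ⟨hl, hlw⟩, hlv'⟩
    rw [← φ.injective hkv]
    exact hk.1

theorem hasPiSymSet_sect {w u e : E4} {φ : E4 ≃ₗᵢ[ℝ] E4} {D : Set E4}
    (hφ : IsRotAngleAbout w u 1 φ) (he : ⟪e, w⟫ = 0)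
    (h : ∀ v, ⟪v, w⟫ = 0 → (v ∈ D ↔ φ v + e ∈ D)) : HasPiSymSet w u (sect w D) := by
  refine ⟨φ, hφ, -e, by rw [inner_neg_left, he, neg_zero], Set.ext fun v => ⟨?_, ?_⟩⟩
  · rintro ⟨k, ⟨hkD, hkw⟩, rfl⟩
    exact ⟨φ k + e, ⟨(h k hkw).1 hkD, by
      rw [inner_add_left, he, inner_map_eq_of_map_eq hφ.1.1, hkw, add_zero]⟩, by simp⟩
  · rintro ⟨l, ⟨hlD, hlw⟩, rfl⟩
    have hw : ⟪φ.symm (l + -e), w⟫ = 0 := by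
      rw [← inner_map_eq_of_map_eq hφ.1.1, φ.apply_symm_apply, inner_add_left, inner_neg_left, he, hlw]
      simp
    refine ⟨φ.symm (l + -e), ⟨(h _ hw).2 ?_, hw⟩, φ.apply_symm_apply _⟩
    simpa using hlD

theorem exists_orthonormalBasis_two_three {w ζ : E4} (hw : ‖w‖ = 1) (hζ : ‖ζ‖ = 1)
    (h : ⟪w, ζ⟫ = 0) : ∃ b : OrthonormalBasis (Fin 4) ℝ E4, b 2 = w ∧ b 3 = ζ := by
  have hv : Orthonormal ℝ (Set.domRestrict ({2, 3} : Set (Fin 4)) ![0, 0, w, ζ]) := by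
    rw [orthonormal_iff_ite]
    rintro ⟨i, rfl | rfl⟩ ⟨j, rfl | rfl⟩ <;>
      simp [Set.domRestrict, hw, hζ, h, real_inner_comm, Subtype.ext_iff]
  obtain ⟨b, hb⟩ := hv.exists_orthonormalBasis_extension_of_card_eq (by simp)
  exact ⟨b, by simpa using hb 2 (by simp), by simpa using hb 3 (by simp)⟩

theorem exists_eq_smul_of_zero_mem_segment {z y ζ : E4} (h0 : (0 : E4) ∈ segment ℝ z y) {q : ℝ}
    (hq : q ≠ 0) (h : y - z = q • ζ) : ∃ r t : ℝ, r ≠ t ∧ z = r • ζ ∧ y = t • ζ := by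
  rw [segment_eq_image'] at h0
  obtain ⟨c, -, hc⟩ := h0
  simp only [h] at hc
  have hz : z = (-(c * q)) • ζ := by rw [eq_neg_of_add_eq_zero_left hc]; module
  refine ⟨-(c * q), q - c * q, fun h' => hq (by linarith), hz, ?_⟩
  rw [← sub_add_cancel y z, h, hz]
  module

theorem mem_image_add_smul_three_iff {b : OrthonormalBasis (Fin 4) ℝ E4} {L : Set E4} {s : ℝ}
    {x : ℂ × ℝ} : hyperplanePoint b x ∈ (fun v => v + s • b 3) '' L ↔
      hyperplanePoint b (x - (0, s)) ∈ L := by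
  rw [Set.image_add_right, Set.mem_preimage, hyperplanePoint_sub, hyperplanePoint_snd,
    sub_eq_add_neg]

theorem rotC_sub_snd (c : Circle) (x : ℂ × ℝ) (s : ℝ) :
    rotC c (x - (0, s)) = rotC c x - (0, s) := by
  simp [rotC]

section Sections

variable {K L M : Set E4} {b : OrthonormalBasis (Fin 4) ℝ E4} {s μ : ℝ}

theorem hasPiSymSet_of_rotC {c : Circle} (hc : (c : ℂ) = -1)
    (h : ∀ x, hyperplanePoint b (x - (0, s)) ∈ L ↔ hyperplanePoint b (rotC c x - (0, s)) ∈ L) :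
    HasPiSymSet (b 2) (b 3) (sect (b 2) L) := by
  refine hasPiSymSet_sect (e := 0) (isRotAngleAbout_halfTurn (orthonormal_three_two b)) (by simp)
    fun v hv => ?_
  obtain ⟨x, rfl⟩ := exists_hyperplanePoint_eq b hv
  rw [halfTurn_three_hyperplanePoint b hc, add_zero]
  convert h (x + (0, s)) using 3 <;> simp [rotC]

theorem exists_hasPiSymSet_of_flipC {c : Circle}
    (h : ∀ x, hyperplanePoint b x ∈ K ↔ hyperplanePoint b (flipC μ c x) ∈ K) :
    ∃ u ∈ S2 (b 3) ∩ S2 (b 2), HasPiSymSet (b 2) u (sect (b 2) K) := by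
  obtain ⟨d, rfl⟩ := Circle.exists_mul_self_eq c
  have hn := norm_hyperplanePoint_circle b d
  refine ⟨hyperplanePoint b (d, 0), ⟨⟨by simpa [sph] using hn, ?_⟩,
    ⟨by simpa [sph] using hn, inner_hyperplanePoint_two' b _⟩⟩, ?_⟩
  · rw [real_inner_comm, inner_hyperplanePoint_three]
  refine hasPiSymSet_sect (e := hyperplanePoint b (0, μ))
    (isRotAngleAbout_halfTurn (orthonormal_circle_two b d)) (inner_hyperplanePoint_two' b _)
    fun v hv => ?_
  obtain ⟨x, rfl⟩ := exists_hyperplanePoint_eq b hv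
  rw [halfTurn_circle_hyperplanePoint, ← hyperplanePoint_add, h]
  convert Iff.rfl using 3
  simp [flipC, sub_eq_neg_add]

theorem DirCong.exists_rotC_or_flipC (hcong : DirCong (b 2) (sect (b 2) K) (sect (b 2) L)) {r t : ℝ}
    (hL : Bornology.IsBounded ((fun x => x + s • b 3) '' L))
    (hstar : StarShapedO ((fun x => x + s • b 3) '' L)) (hrt : r ≠ t)
    (hdK : IsDiamStar K (r • b 3) (t • b 3))
    (hdL : IsDiamStar ((fun x => x + s • b 3) '' L) (r • b 3) (t • b 3))
    (hD : ∀ v ∈ diamEndpoints ((fun x => x + s • b 3) '' L), ⟪v, b 2⟫ = 0 →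
      ∃ q : ℝ, v = q • b 3) :
    (∃ c, ∀ x, hyperplanePoint b x ∈ K ↔ hyperplanePoint b (rotC c x - (0, s)) ∈ L) ∨
      ∃ c, ∀ x, hyperplanePoint b x ∈ K ↔ hyperplanePoint b (flipC (r + t) c x - (0, s)) ∈ L := by
  have h32 : ⟪b 3, b 2⟫ = 0 := by simp [b.inner_eq_ite]
  obtain ⟨φ, hφ, d, hd, hiff⟩ := hcong.exists_mem_iff (a := s • b 3)
    (by rw [real_inner_smul_left, h32, mul_zero])
  rcases hdK.map_eq_or_eq_neg hL hstar (b.orthonormal.1 3) h32 hφ.1 hd hiff hrt hdL hD with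
    ⟨h3, rfl⟩ | ⟨h3, rfl⟩
  · obtain ⟨c, hc⟩ := hφ.exists_rotC b h3
    refine Or.inl ⟨c, fun x => ?_⟩
    rw [hiff _ (inner_hyperplanePoint_two' b x), hc, add_zero, mem_image_add_smul_three_iff]
  · obtain ⟨c, hc⟩ := hφ.exists_flipC b h3
    refine Or.inr ⟨c, fun x => ?_⟩
    rw [hiff _ (inner_hyperplanePoint_two' b x), hc, ← hyperplanePoint_snd b (r + t),
      ← hyperplanePoint_add, mem_image_add_smul_three_iff]
    convert Iff.rfl using 4
    simp [flipC, sub_eq_neg_add]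

theorem exists_isRot_radialFn_eq {c : Circle}
    (h : ∀ x, hyperplanePoint b x ∈ K ↔ hyperplanePoint b (rotC c x) ∈ M) :
    ∃ φ : E4 ≃ₗᵢ[ℝ] E4, IsRot (b 2) φ ∧ φ (b 3) = b 3 ∧
      ∀ θ ∈ S2 (b 2), radialFn K (φ θ) = radialFn M θ := by
  obtain ⟨φ, hφ, hc⟩ := exists_isRot_eq_rotC b c⁻¹
  refine ⟨φ, hφ, ?_, fun θ hθ => ?_⟩
  · simpa [hyperplanePoint_snd, rotC] using hc (0, 1)
  · obtain ⟨x, rfl⟩ := exists_hyperplanePoint_eq b hθ.2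
    refine congrArg sSup (Set.ext fun q => ?_)
    simp only [Set.mem_ofPred_eq]
    rw [← map_smul, ← hyperplanePoint_smul, hc, h, rotC_rotC, mul_inv_cancel, rotC_one]

end Sections


/-- Lemma: for `w ∈ Ω^r` there is a rotation carrying the radial
function of `K` to that of `L̃` on `S²(w)`. -/
theorem stmt_17 (K L : Set E4) (hK : IsStarBody K) (hL : IsStarBody L)
    (hKc : CountablyManyDiamsStar K) (hLc : CountablyManyDiamsStar L)
    (ζ : E4) (hζ : ζ ∈ sph)
    (hd : ∃ z y : E4, IsDiamStar K z y ∧ (0 : E4) ∈ segment ℝ z y ∧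
      ∃ s : ℝ, s ≠ 0 ∧ y - z = s • ζ)
    (hcong : ∀ w ∈ S2 ζ, DirCong w (sect w K) (sect w L))
    (hsym : ∀ w ∈ S2 ζ,
      (¬ HasPiSymSet w ζ (sect w K) ∧ ¬ HasPiSymSet w ζ (sect w L)) ∧
      ∀ u ∈ S2 ζ ∩ S2 w, ¬ HasPiSymSet w u (sect w K) ∧ ¬ HasPiSymSet w u (sect w L))
    (a : E4) (ha : ∃ s : ℝ, a = s • ζ)
    (hstar : StarShapedO ((fun x => x + a) '' L))
    (hdd : ∃ z y : E4, IsDiamStar K z y ∧ (0 : E4) ∈ segment ℝ z y ∧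
      (∃ s : ℝ, s ≠ 0 ∧ y - z = s • ζ) ∧ IsDiamStar ((fun x => x + a) '' L) z y) :
    ∀ w ∈ OmegaR K L ζ, ∃ φ : E4 ≃ₗᵢ[ℝ] E4, IsRot w φ ∧ (φ ζ = ζ ∨ φ ζ = -ζ) ∧
      ∀ θ ∈ S2 w, radialFn K (φ θ) = radialFn ((fun x => x + a) '' L) θ := by
  intro w hw
  obtain ⟨s, rfl⟩ := ha
  obtain ⟨z, y, hdK, h0, ⟨q, hq, hzy⟩, hdL⟩ := hdd
  obtain ⟨r, t, hrt, rfl, rfl⟩ := exists_eq_smul_of_zero_mem_segment h0 hq hzy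
  obtain ⟨b, hb2, rfl⟩ := exists_orthonormalBasis_two_three (by simpa [sph] using hw.1.1)
    (by simpa [sph] using hζ) hw.1.2
  set M := (fun x => x + s • b 3) '' L with hM
  have hMb : Bornology.IsBounded M := (hL.1.1.image (by fun_prop)).isBounded
  have hmem : ∀ p, sphericalFrame b p 2 ∈ S2 (b 3) := fun p =>
    ⟨by simp [sph], by rw [← sphericalFrame_three b p]; simp⟩
  obtain ⟨c, hc⟩ := exists_rotC_of_dense (hK.isContinuousFamily b 0) (hL.isContinuousFamily b s)
    (r + t)
    (fun p c hc h => (hsym _ (hmem p)).1.2 (by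
      rw [← sphericalFrame_three b p]
      exact hasPiSymSet_of_rotC hc h))
    (fun p c h => by
      obtain ⟨u, hu, hsymu⟩ := exists_hasPiSymSet_of_flipC (b := sphericalFrame b p) (K := K)
        fun x => by simpa only [Set.mem_ofPred_eq, Prod.mk_zero_zero, sub_zero] using h x
      rw [sphericalFrame_three] at hu
      exact ((hsym _ (hmem p)).2 u hu).1 hsymu)
    ((dense_forall_inner_sphericalFrame_two b
        (hLc.image_add_right (s • b 3)).countable_diamEndpoints).mono fun p hp => by
      have h := DirCong.exists_rotC_or_flipC (b := sphericalFrame b p) (s := s) (r := r) (t := t)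
        (hcong _ (hmem p))
      rw [sphericalFrame_three] at h
      simpa only [Set.mem_ofPred_eq, Prod.mk_zero_zero, sub_zero] using
        h hMb hstar hrt hdK hdL hp)
    (fun φ x => by
      rw [Set.mem_ofPred_eq, hyperplanePoint_sphericalFrame_zero, rotC_sub_snd, Set.mem_ofPred_eq])
    (fun φ x => by
      rw [Set.mem_ofPred_eq, hyperplanePoint_sphericalFrame_zero, rotC_sub_snd, Set.mem_ofPred_eq])
    (fun φ x => by
      rw [Set.mem_ofPred_eq, hyperplanePoint_sphericalFrame_pi, rotC_sub_snd, Set.mem_ofPred_eq])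
    (fun φ x => by
      rw [Set.mem_ofPred_eq, hyperplanePoint_sphericalFrame_pi, rotC_sub_snd, Set.mem_ofPred_eq])
    (fun θ => by simp only [hyperplanePoint_sphericalFrame_two_pi])
    (fun θ => by simp only [hyperplanePoint_sphericalFrame_two_pi])
  obtain ⟨φ, hφ, hφ3, hρ⟩ := exists_isRot_radialFn_eq (b := sphericalFrame b (0, 0)) (K := K)
    (M := M) (c := c) fun x => by
      rw [hM, ← sphericalFrame_three b (0, 0), mem_image_add_smul_three_iff]
      simpa only [Set.mem_ofPred_eq, Prod.mk_zero_zero, sub_zero] using hc x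
  rw [sphericalFrame_zero_zero_two, hb2] at hφ hρ
  rw [sphericalFrame_three] at hφ3
  exact ⟨φ, hφ, Or.inl hφ3, hρ⟩
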